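/- arXiv:2411.01746 — 3 statements merged into one kernel-verified Lean document; each statement's English description precedes it below -/
import Mathlib

section
/- Let V be a real vector space, N : V → ℝ a seminorm (subadditive and absolutely homogeneous), L : V → V any map, and Δt ≥ 0. Assume the forward Euler step is N-nonincreasing: N(v + Δt • L v) ≤ N v for all v ∈ V. Define one TVDRK3 step from z ∈ V by z₁ = z + Δt • L z, z₂ = (3/4) • z + (1/4) • z₁ + (Δt/4) • L z₁, z' = (1/3) • z + (2/3) • z₂ + (2Δt/3) • L z₂. Then N z' ≤ N z. -/
/-- A subadditive, absolutely homogeneous functional satisfies the convexity inequality for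
nonnegative coefficients. -/
theorem map_smul_add_smul_le_of_subadditive {V : Type*} [AddCommGroup V] [Module ℝ V] {N : V → ℝ}
    (Nsub : ∀ x y : V, N (x + y) ≤ N x + N y)
    (Nhom : ∀ (c : ℝ) (x : V), N (c • x) = |c| * N x)
    {a b : ℝ} (ha : 0 ≤ a) (hb : 0 ≤ b) (x y : V) :
    N (a • x + b • y) ≤ a * N x + b * N y := by
  simpa only [Nhom, abs_of_nonneg ha, abs_of_nonneg hb] using Nsub (a • x) (b • y)

/-- Strong-stability-preserving property of TVDRK3: if a seminorm is
nonincreasing under a forward Euler step, it is nonincreasing under a full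
TVDRK3 step. -/
theorem tvdrk3_ssp
    {V : Type*} [AddCommGroup V] [Module ℝ V]
    (N : V → ℝ)
    (Nsub : ∀ x y : V, N (x + y) ≤ N x + N y)
    (Nhom : ∀ (c : ℝ) (x : V), N (c • x) = |c| * N x)
    (L : V → V) (Δt : ℝ) (hΔt : 0 ≤ Δt)
    (hEuler : ∀ v : V, N (v + Δt • L v) ≤ N v)
    (z z₁ z₂ z' : V)
    (hz₁ : z₁ = z + Δt • L z)
    (hz₂ : z₂ = (3/4 : ℝ) • z + (1/4 : ℝ) • z₁ + (Δt/4) • L z₁)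
    (hz' : z' = (1/3 : ℝ) • z + (2/3 : ℝ) • z₂ + (2*Δt/3) • L z₂) :
    N z' ≤ N z := by
  have hconv {a b : ℝ} (ha : 0 ≤ a) (hb : 0 ≤ b) (x y : V) :=
    map_smul_add_smul_le_of_subadditive Nsub Nhom ha hb x y
  have h₁ : N z₁ ≤ N z := hz₁ ▸ hEuler z
  have h₂ : N z₂ ≤ N z := by
    have hc : z₂ = (3/4 : ℝ) • z + (1/4 : ℝ) • (z₁ + Δt • L z₁) := by
      rw [hz₂]; module
    rw [hc]
    linarith [hconv (a := 3/4) (b := 1/4) (by norm_num) (by norm_num) z (z₁ + Δt • L z₁),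
      hEuler z₁]
  have hc : z' = (1/3 : ℝ) • z + (2/3 : ℝ) • (z₂ + Δt • L z₂) := by
    rw [hz']; module
  rw [hc]
  linarith [hconv (a := 1/3) (b := 2/3) (by norm_num) (by norm_num) z (z₂ + Δt • L z₂),
    hEuler z₂]
end

section
/- (Harten's TVD lemma, periodic form.) Let n ≥ 1 and let u, C, D : ZMod n → ℝ satisfy 0 ≤ C j, 0 ≤ D j, and C j + D j ≤ 1 for every j ∈ ZMod n. Define the updated sequence v : ZMod n → ℝ by v j = u j + C j · (u (j+1) − u j) − D (j−1) · (u j − u (j−1)). Then TV(v) ≤ TV(u), i.e. Σ_{j ∈ ZMod n} |v (j+1) − v j| ≤ Σ_{j ∈ ZMod n} |u (j+1) − u j|. -/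
/-- Harten's TVD lemma in periodic form: an incremental-form update with
nonnegative coefficients summing to at most one is total-variation diminishing. -/
theorem harten_tvd_lemma_periodic
    (n : ℕ) [NeZero n] (u C D v : ZMod n → ℝ)
    (hC : ∀ j : ZMod n, 0 ≤ C j)
    (hD : ∀ j : ZMod n, 0 ≤ D j)
    (hCD : ∀ j : ZMod n, C j + D j ≤ 1)
    (hv : ∀ j : ZMod n,
      v j = u j + C j * (u (j + 1) - u j) - D (j - 1) * (u j - u (j - 1))) :
    ∑ j : ZMod n, |v (j + 1) - v j| ≤ ∑ j : ZMod n, |u (j + 1) - u j| := by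
  have hpoint : ∀ j : ZMod n, |v (j + 1) - v j| ≤
      (1 - C j - D j) * |u (j + 1) - u j| + C (j + 1) * |u (j + 1 + 1) - u (j + 1)| +
        D (j - 1) * |u (j - 1 + 1) - u (j - 1)| := by
    intro j
    have hdiff : v (j + 1) - v j =
        (1 - C j - D j) * (u (j + 1) - u j) + C (j + 1) * (u (j + 1 + 1) - u (j + 1)) +
          D (j - 1) * (u (j - 1 + 1) - u (j - 1)) := by
      rw [hv (j + 1), hv j, add_sub_cancel_right, sub_add_cancel]
      ring
    have hcoeff : 0 ≤ 1 - C j - D j := by linarith [hCD j]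
    rw [hdiff]
    refine (abs_add_three _ _ _).trans_eq ?_
    rw [abs_mul, abs_mul, abs_mul, abs_of_nonneg hcoeff, abs_of_nonneg (hC _),
      abs_of_nonneg (hD _)]
  have hshiftC : ∑ j : ZMod n, C (j + 1) * |u (j + 1 + 1) - u (j + 1)| =
      ∑ j : ZMod n, C j * |u (j + 1) - u j| :=
    Equiv.sum_comp (Equiv.addRight (1 : ZMod n)) fun j => C j * |u (j + 1) - u j|
  have hshiftD : ∑ j : ZMod n, D (j - 1) * |u (j - 1 + 1) - u (j - 1)| =
      ∑ j : ZMod n, D j * |u (j + 1) - u j| :=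
    Equiv.sum_comp (Equiv.subRight (1 : ZMod n)) fun j => D j * |u (j + 1) - u j|
  refine (Finset.sum_le_sum fun j _ => hpoint j).trans_eq ?_
  rw [Finset.sum_add_distrib, Finset.sum_add_distrib, hshiftC, hshiftD,
    ← Finset.sum_add_distrib, ← Finset.sum_add_distrib]
  exact Finset.sum_congr rfl fun j _ => by ring
end

section
/- Let n ≥ 1, a ≥ 0, let f : ℝ → ℝ be Lipschitz with constant a, and let λ ≥ 0 satisfy λ·a ≤ 1. For u : ZMod n → ℝ define the first-order local Lax–Friedrichs update v : ZMod n → ℝ by v j = u j − (λ/2)(f(u (j+1)) − f(u (j−1))) + (λa/2)(u (j+1) − 2·u j + u (j−1)). Then the scheme is total-variation diminishing: Σ_{j ∈ ZMod n} |v (j+1) − v j| ≤ Σ_{j ∈ ZMod n} |u (j+1) − u j|. -/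
/-- Harten's lemma on a periodic grid: if every jump `d j` is split, without increasing its
absolute value, into a part that stays, a part `p j` that moves left and a part `m j` that moves
right, then the total variation does not increase. -/
theorem sum_abs_incremental_le {n : ℕ} [NeZero n] (d p m : ZMod n → ℝ)
    (h : ∀ j, |d j - p j - m j| + |p j| + |m j| ≤ |d j|) :
    ∑ j, |d j - p j - m j + p (j + 1) + m (j - 1)| ≤ ∑ j, |d j| := by
  have hp : ∑ j, |p (j + 1)| = ∑ j, |p j| :=
    Equiv.sum_comp (Equiv.addRight (1 : ZMod n)) fun j => |p j|
  have hm : ∑ j, |m (j - 1)| = ∑ j, |m j| :=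
    Equiv.sum_comp (Equiv.subRight (1 : ZMod n)) fun j => |m j|
  calc ∑ j, |d j - p j - m j + p (j + 1) + m (j - 1)|
      ≤ ∑ j, (|d j - p j - m j| + |p (j + 1)| + |m (j - 1)|) :=
        Finset.sum_le_sum fun j _ => abs_add_three _ _ _
    _ = ∑ j, (|d j - p j - m j| + |p j| + |m j|) := by
        simp only [Finset.sum_add_distrib, hp, hm]
    _ ≤ ∑ j, |d j| := Finset.sum_le_sum fun j _ => h j

/-- Under the CFL condition, the Lax–Friedrichs splitting of a jump `d` with flux jump `g` does
not increase its absolute value. -/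
theorem abs_lax_friedrichs_split_le {a lam d g : ℝ} (hlam : 0 ≤ lam) (hCFL : lam * a ≤ 1)
    (ha : 0 ≤ a) (hg : |g| ≤ a * |d|) :
    |d - lam / 2 * (a * d - g) - lam / 2 * (a * d + g)| + |lam / 2 * (a * d - g)|
      + |lam / 2 * (a * d + g)| ≤ |d| := by
  have hstay : d - lam / 2 * (a * d - g) - lam / 2 * (a * d + g) = (1 - lam * a) * d := by ring
  have hsplit : |a * d - g| + |a * d + g| ≤ 2 * (a * |d|) := by
    have had : |a * d| = a * |d| := by rw [abs_mul, abs_of_nonneg ha]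
    grind
  rw [hstay, abs_mul, abs_mul, abs_mul, abs_of_nonneg (sub_nonneg.2 hCFL),
    abs_of_nonneg (by positivity : 0 ≤ lam / 2)]
  linarith [mul_le_mul_of_nonneg_left hsplit hlam]

/-- The first-order local Lax–Friedrichs scheme with periodic boundary
conditions is total-variation diminishing under the CFL condition `λ a ≤ 1`. -/
theorem local_lax_friedrichs_tvd
    (n : ℕ) [NeZero n]
    (a : ℝ) (ha : 0 ≤ a) (f : ℝ → ℝ)
    (hf : ∀ v w : ℝ, |f v - f w| ≤ a * |v - w|)
    (lam : ℝ) (hlam : 0 ≤ lam) (hCFL : lam * a ≤ 1)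
    (u v : ZMod n → ℝ)
    (hv : ∀ j : ZMod n,
      v j = u j - (lam / 2) * (f (u (j + 1)) - f (u (j - 1)))
            + (lam * a / 2) * (u (j + 1) - 2 * u j + u (j - 1))) :
    ∑ j : ZMod n, |v (j + 1) - v j| ≤ ∑ j : ZMod n, |u (j + 1) - u j| := by
  have h := sum_abs_incremental_le (fun j => u (j + 1) - u j)
    (fun j => lam / 2 * (a * (u (j + 1) - u j) - (f (u (j + 1)) - f (u j))))
    (fun j => lam / 2 * (a * (u (j + 1) - u j) + (f (u (j + 1)) - f (u j))))
    fun j => abs_lax_friedrichs_split_le hlam hCFL ha (hf _ _)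
  refine le_of_eq_of_le (Finset.sum_congr rfl fun j _ => congrArg _ ?_) h
  simp only [hv, add_sub_cancel_right, sub_add_cancel]
  ring
end
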